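/- Let 𝒪 be an order in a product of number fields K with normalization 𝒪̃. Then ∏_𝔭 #(𝒪̃_𝔭^×/𝒪_𝔭^×) = #(𝒪̃/𝒪) · ∏_𝔭 [ ∏_{𝔓 | 𝔭} (1 − N𝔓^{−1}) ] / (1 − N𝔭^{−1}), where both products are over all maximal ideals 𝔭 of 𝒪 and all but finitely many factors equal 1. -/

import Mathlib

set_option maxHeartbeats 1000000
set_option synthInstance.maxHeartbeats 2000000

noncomputable section

open NumberField Filter Topology

/-- The localization `𝒪̃_𝔭` of the normalization `𝒪̃ = integralClosure ℤ A` of an order `𝒪`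
at the multiplicative set `𝒪 ∖ 𝔭`, for `𝔭` a maximal ideal of `𝒪`. -/
noncomputable def NormLoc {A : Type} [CommRing A] (O : Subalgebra ℤ A)
    (hle : O ≤ integralClosure ℤ A) (𝔭 : MaximalSpectrum ↥O) : Type :=
  Localization (Submonoid.map ((Subalgebra.inclusion hle).toRingHom :
    ↥O →+* ↥(integralClosure ℤ A)) 𝔭.asIdeal.primeCompl)

noncomputable instance NormLoc.instCommRing {A : Type} [CommRing A] (O : Subalgebra ℤ A)
    (hle : O ≤ integralClosure ℤ A) (𝔭 : MaximalSpectrum ↥O) :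
    CommRing (NormLoc O hle 𝔭) :=
  inferInstanceAs (CommRing (Localization (Submonoid.map
    ((Subalgebra.inclusion hle).toRingHom : ↥O →+* ↥(integralClosure ℤ A))
    𝔭.asIdeal.primeCompl)))

noncomputable instance NormLoc.instAlgebra {A : Type} [CommRing A] (O : Subalgebra ℤ A)
    (hle : O ≤ integralClosure ℤ A) (𝔭 : MaximalSpectrum ↥O) :
    Algebra ↥(integralClosure ℤ A) (NormLoc O hle 𝔭) :=
  inferInstanceAs (Algebra ↥(integralClosure ℤ A) (Localization (Submonoid.map
    ((Subalgebra.inclusion hle).toRingHom : ↥O →+* ↥(integralClosure ℤ A))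
    𝔭.asIdeal.primeCompl)))

noncomputable instance NormLoc.instIsLocalization {A : Type} [CommRing A] (O : Subalgebra ℤ A)
    (hle : O ≤ integralClosure ℤ A) (𝔭 : MaximalSpectrum ↥O) :
    IsLocalization (Submonoid.map ((Subalgebra.inclusion hle).toRingHom :
      ↥O →+* ↥(integralClosure ℤ A)) 𝔭.asIdeal.primeCompl) (NormLoc O hle 𝔭) :=
  inferInstanceAs (IsLocalization (Submonoid.map
    ((Subalgebra.inclusion hle).toRingHom : ↥O →+* ↥(integralClosure ℤ A))
    𝔭.asIdeal.primeCompl) (Localization (Submonoid.map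
    ((Subalgebra.inclusion hle).toRingHom : ↥O →+* ↥(integralClosure ℤ A))
    𝔭.asIdeal.primeCompl)))

/-- The natural map `𝒪_𝔭 → 𝒪̃_𝔭`. -/
noncomputable def normLocMap {A : Type} [CommRing A] (O : Subalgebra ℤ A)
    (hle : O ≤ integralClosure ℤ A) (𝔭 : MaximalSpectrum ↥O) :
    Localization.AtPrime 𝔭.asIdeal →+* NormLoc O hle 𝔭 :=
  IsLocalization.map (NormLoc O hle 𝔭) ((Subalgebra.inclusion hle).toRingHom :
      ↥O →+* ↥(integralClosure ℤ A))
    (Submonoid.le_comap_map 𝔭.asIdeal.primeCompl)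

/-- The group `𝒪̃_𝔭ˣ/𝒪_𝔭ˣ`. -/
noncomputable abbrev localUnitsQuot {A : Type} [CommRing A] (O : Subalgebra ℤ A)
    (hle : O ≤ integralClosure ℤ A) (𝔭 : MaximalSpectrum ↥O) : Type :=
  (NormLoc O hle 𝔭)ˣ ⧸ (Units.map (normLocMap O hle 𝔭).toMonoidHom).range

theorem card_ker_unitsMap_quotientMk {B : Type*} [CommRing B] (J : Ideal B)
    (hJ : ∀ x ∈ J, IsUnit (1 + x)) :
    Nat.card (Units.map (Ideal.Quotient.mk J).toMonoidHom).ker = Nat.card J := by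
  refine Nat.card_congr (Equiv.ofBijective
    (fun u => ⟨(u.1 : B) - 1, ?_⟩) ⟨fun u v h => ?_, fun x => ?_⟩)
  · have h := congrArg Units.val (MonoidHom.mem_ker.mp u.2)
    exact Ideal.Quotient.eq.mp (h.trans (map_one _).symm)
  · ext
    simpa using congrArg Subtype.val h
  · obtain ⟨u, hu⟩ := hJ x x.2
    refine ⟨⟨u, ?_⟩, ?_⟩
    · rw [MonoidHom.mem_ker]
      ext
      change Ideal.Quotient.mk J (u : B) = 1
      rw [hu, map_add, Ideal.Quotient.eq_zero_iff_mem.mpr x.2, map_one, add_zero]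
    · ext
      simp [hu]

theorem unitsMap_quotientMk_surjective {B : Type*} [CommRing B] (J : Ideal B)
    (hJ : ∀ x ∈ J, IsUnit (1 + x)) :
    Function.Surjective (Units.map (Ideal.Quotient.mk J).toMonoidHom) := by
  intro u
  obtain ⟨a, ha⟩ := Ideal.Quotient.mk_surjective (u : B ⧸ J)
  obtain ⟨b, hb⟩ := Ideal.Quotient.mk_surjective ((u⁻¹ : (B ⧸ J)ˣ) : B ⧸ J)
  have hab : a * b - 1 ∈ J := by
    rw [← Ideal.Quotient.eq, map_mul, ha, hb, map_one, Units.mul_inv]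
  have := hJ _ hab
  rw [add_sub_cancel] at this
  obtain ⟨v, hv⟩ := isUnit_of_mul_isUnit_left this
  exact ⟨v, Units.ext ((congrArg _ hv).trans ha)⟩

theorem card_units_eq_card_mul_tprod (B : Type*) [CommRing B] [Finite B] :
    (Nat.card Bˣ : ℝ) = Nat.card B *
      ∏' m : MaximalSpectrum B, (1 - (Nat.card (B ⧸ m.asIdeal) : ℝ)⁻¹) := by
  classical
  set J := nilradical B
  have hJ : ∀ x ∈ J, IsUnit (1 + x) := fun x hx => (mem_nilradical.mp hx).isUnit_one_add
  let hquot := (IsArtinianRing.quotNilradicalEquivPi B).toRingEquiv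
  have := Fintype.ofFinite (MaximalSpectrum B)
  have h1 : Nat.card Bˣ = Nat.card J * Nat.card (B ⧸ J)ˣ := by
    rw [← card_ker_unitsMap_quotientMk J hJ, 
      ← Subgroup.card_mul_index (Units.map (Ideal.Quotient.mk J).toMonoidHom).ker,
      Subgroup.index_ker,
      MonoidHom.range_eq_top.mpr (unitsMap_quotientMk_surjective J hJ), Subgroup.card_top]
  have h2 : Nat.card B = Nat.card J * Nat.card (B ⧸ J) := Submodule.card_eq_card_quotient_mul_card J
  have h3 : Nat.card (B ⧸ J) = ∏ m : MaximalSpectrum B, Nat.card (B ⧸ m.asIdeal) := by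
    rw [Nat.card_congr hquot.toEquiv, Nat.card_pi]
  have h4 : Nat.card (B ⧸ J)ˣ = ∏ m : MaximalSpectrum B, (Nat.card (B ⧸ m.asIdeal) - 1) := by
    rw [Nat.card_congr ((Units.mapEquiv hquot.toMulEquiv).trans MulEquiv.piUnits).toEquiv,
      Nat.card_pi]
    refine Finset.prod_congr rfl fun m _ => ?_
    let := Ideal.Quotient.field m.asIdeal
    exact Nat.card_units _
  rw [h1, h2, h3, h4, tprod_fintype]
  push_cast
  rw [mul_assoc, ← Finset.prod_mul_distrib]
  congr 1
  refine Finset.prod_congr rfl fun m _ => ?_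
  have : Finite (B ⧸ m.asIdeal) := Finite.of_surjective _ Ideal.Quotient.mk_surjective
  have : 1 ≤ Nat.card (B ⧸ m.asIdeal) := Nat.card_pos
  rw [Nat.cast_sub this, mul_sub, mul_inv_cancel₀ (by positivity)]
  simp

/-- The unit count of a finite quotient of `S`, in terms of the maximal ideals of `S`. -/
theorem card_units_of_surjective {S B : Type*} [CommRing S] [CommRing B] [Finite B] (f : S →+* B)
    (hf : Function.Surjective f) (P : MaximalSpectrum S → Prop)
    (hP : ∀ m, P m ↔ RingHom.ker f ≤ m.asIdeal) :
    (Nat.card Bˣ : ℝ) = Nat.card B *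
      ∏' m : {m : MaximalSpectrum S // P m}, (1 - (Nat.card (S ⧸ m.1.asIdeal) : ℝ)⁻¹) := by
  rw [card_units_eq_card_mul_tprod B]
  congr 1
  let e : MaximalSpectrum B ≃ {m : MaximalSpectrum S // P m} :=
    { toFun := fun m => ⟨⟨m.asIdeal.comap f,
          have := m.isMaximal; Ideal.comap_isMaximal_of_surjective f hf⟩,
          (hP _).mpr (Ideal.comap_mono bot_le)⟩
      invFun := fun m => ⟨m.1.asIdeal.map f, by
          have := m.1.isMaximal
          refine (Ideal.map_eq_top_or_isMaximal_of_surjective f hf m.1.isMaximal).resolve_left ?_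
          intro h
          have := congrArg (Ideal.comap f) h
          rw [Ideal.comap_map_of_surjective' f hf, Ideal.comap_top,
            sup_eq_left.mpr ((hP _).mp m.2)] at this
          exact m.1.isMaximal.ne_top this⟩
      left_inv := fun m => MaximalSpectrum.ext (Ideal.map_comap_of_surjective f hf _)
      right_inv := fun m => Subtype.ext (MaximalSpectrum.ext (by
        change Ideal.comap f (Ideal.map f _) = _
        rw [Ideal.comap_map_of_surjective' f hf, sup_eq_left.mpr ((hP _).mp m.2)])) }
  rw [← e.tprod_eq]
  refine tprod_congr fun m => ?_
  have : Nat.card (S ⧸ m.asIdeal.comap f) = Nat.card (B ⧸ m.asIdeal) :=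
    Nat.card_congr (Equiv.ofBijective (Ideal.quotientMap m.asIdeal f le_rfl)
      ⟨Ideal.quotientMap_injective, Ideal.quotientMap_surjective hf⟩)
  rw [← this]
  rfl

/-- Index of the units of a local subring whose maximal ideal contains an ideal of finite index
of the overring. -/
theorem card_units_quotient_mul {L M : Type*} [CommRing L] [CommRing M] [IsLocalRing L]
    (g : L →+* M) (hg : Function.Injective g) (J : Ideal M)
    (hJ : ∀ x ∈ J, ∃ y ∈ IsLocalRing.maximalIdeal L, g y = x) :
    Nat.card (Mˣ ⧸ (Units.map g.toMonoidHom).range) * Nat.card (L ⧸ J.comap g)ˣ =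
        Nat.card (M ⧸ J)ˣ ∧
      Nat.card (M ⧸ g.toAddMonoidHom.range) * Nat.card (L ⧸ J.comap g) = Nat.card (M ⧸ J) := by
  have hJL : ∀ y ∈ J.comap g, IsUnit (1 + y) := by
    intro y hy
    obtain ⟨y', hy', h⟩ := hJ _ hy
    rw [hg h] at hy'
    by_contra hcon
    have := (IsLocalRing.maximalIdeal L).sub_mem ((IsLocalRing.mem_maximalIdeal _).mpr hcon) hy'
    rw [add_sub_cancel_right] at this
    exact (Ideal.ne_top_iff_one _).mp (IsLocalRing.maximalIdeal.isMaximal L).ne_top this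
  have hJM : ∀ x ∈ J, IsUnit (1 + x) := by
    intro x hx
    obtain ⟨y, hy, rfl⟩ := hJ x hx
    rw [← map_one g, ← map_add]
    exact (hJL y hx).map g
  set H := (Units.map g.toMonoidHom).range with hH
  set φ := Units.map (Ideal.Quotient.mk J).toMonoidHom
  have hφs : Function.Surjective φ := unitsMap_quotientMk_surjective J hJM
  set ι : L ⧸ J.comap g →+* M ⧸ J := Ideal.quotientMap J g le_rfl
  have hιi : Function.Injective ι := Ideal.quotientMap_injective
  have hker : φ.ker ≤ H := by
    intro u hu
    have h1 : (u : M) - 1 ∈ J :=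
      Ideal.Quotient.eq.mp ((congrArg Units.val (MonoidHom.mem_ker.mp hu)).trans (map_one _).symm)
    obtain ⟨y, hy, hyu⟩ := hJ _ h1
    obtain ⟨v, hv⟩ := hJL y (by rw [Ideal.mem_comap, hyu]; exact h1)
    refine ⟨v, Units.ext ?_⟩
    change g v = u
    rw [hv, map_add, hyu, map_one, add_sub_cancel]
  have hmap : H.map φ = (Units.map ι.toMonoidHom).range := by
    have hcomp : φ.comp (Units.map g.toMonoidHom) =
        (Units.map ι.toMonoidHom).comp (Units.map (Ideal.Quotient.mk (J.comap g)).toMonoidHom) := by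
      ext u
      rfl
    rw [hH, MonoidHom.map_range, hcomp, MonoidHom.range_comp,
      MonoidHom.range_eq_top.mpr (unitsMap_quotientMk_surjective _ hJL), ← MonoidHom.range_eq_map]
  constructor
  · change H.index * _ = _
    rw [← Subgroup.index_map_eq H hφs hker, ← Subgroup.index_mul_card (H.map φ), hmap]
    congr 1
    exact Nat.card_congr (MonoidHom.ofInjective (Units.map_injective hιi)).toEquiv
  · have hle : J.toAddSubgroup ≤ g.toAddMonoidHom.range := by
      intro x hx
      obtain ⟨y, -, rfl⟩ := hJ x hx
      exact ⟨y, rfl⟩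
    have := AddSubgroup.relIndex_mul_index hle
    rw [← AddSubgroup.index_comap, mul_comm] at this
    exact this

theorem card_eq_card_mul_card_of_exact {A B C : Type*} [AddCommGroup A] [AddCommGroup B]
    [AddCommGroup C] (f : A →+ B) (g : B →+ C) (hf : Function.Injective f)
    (hg : Function.Surjective g) (h : Function.Exact f g) :
    Nat.card B = Nat.card A * Nat.card C := by
  rw [← AddSubgroup.card_mul_index f.range, Nat.card_congr (AddMonoidHom.ofInjective hf).toEquiv,
    ← AddMonoidHom.exact_iff.mp h, AddSubgroup.index_ker, AddMonoidHom.range_eq_top.mpr hg,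
    AddSubgroup.card_top]

theorem card_localizedModule_eq_mul {R N : Type*} [CommRing R] [AddCommGroup N] [Module R N]
    (T : Submonoid R) (N' : Submodule R N) :
    Nat.card (LocalizedModule T N) =
      Nat.card (LocalizedModule T N') * Nat.card (LocalizedModule T (N ⧸ N')) :=
  card_eq_card_mul_card_of_exact (LocalizedModule.map T N'.subtype).toAddMonoidHom
    (LocalizedModule.map T N'.mkQ).toAddMonoidHom
    (LocalizedModule.map_injective T _ N'.subtype_injective)
    (LocalizedModule.map_surjective T _ N'.mkQ_surjective)
    (LocalizedModule.map_exact T _ _ (LinearMap.exact_subtype_mkQ N'))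

open scoped Classical in
theorem card_localizedModule_of_isSimpleModule {R N : Type*} [CommRing R] [AddCommGroup N]
    [Module R N] [IsSimpleModule R N] :
    ∃ m : MaximalSpectrum R, ∀ p : MaximalSpectrum R,
      Nat.card (LocalizedModule p.asIdeal.primeCompl N) = if p = m then Nat.card N else 1 := by
  obtain ⟨I, hI, ⟨e⟩⟩ := isSimpleModule_iff_quot_maximal.mp ‹IsSimpleModule R N›
  refine ⟨⟨I, hI⟩, fun p => ?_⟩
  have hsmul : ∀ r ∈ I, ∀ x : N, r • x = 0 := by
    intro r hr x
    apply e.injective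
    obtain ⟨y, hy⟩ := Ideal.Quotient.mk_surjective (e x)
    rw [map_smul, map_zero, ← hy, Algebra.smul_def, Ideal.Quotient.algebraMap_eq,
      Ideal.Quotient.eq_zero_iff_mem.mpr hr, zero_mul]
  split_ifs with h
  · subst h
    have hinv : ∀ t ∉ I, ∃ s : R, ∀ x : N, t • s • x = x ∧ s • t • x = x := by
      intro t ht
      obtain ⟨s, hs⟩ := hI.exists_inv ht
      obtain ⟨i, hi, h⟩ := hs
      have key : ∀ x : N, (s * t) • x = x := by
        intro x
        have := congrArg (· • x) h
        simpa [add_smul, hsmul i hi x] using this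
      exact ⟨s, fun x => ⟨by rw [smul_smul, mul_comm, key], by rw [smul_smul, key]⟩⟩
    have : IsLocalizedModule I.primeCompl (LinearMap.id : N →ₗ[R] N) := by
      refine ⟨fun t => ?_, fun y => ⟨(y, 1), by simp⟩, fun h => ⟨1, by simpa using h⟩⟩
      obtain ⟨s, hs⟩ := hinv t t.2
      rw [Module.End.isUnit_iff]
      exact Function.bijective_iff_has_inverse.mpr ⟨fun x => s • x, fun x => (hs x).2,
        fun x => (hs x).1⟩
    exact Nat.card_congr (IsLocalizedModule.iso I.primeCompl (LinearMap.id : N →ₗ[R] N)).toEquiv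
  · obtain ⟨t, htI, htp⟩ : ∃ t ∈ I, t ∉ p.asIdeal := by
      by_contra! hcon
      exact h (MaximalSpectrum.ext (hI.eq_of_le p.isMaximal.ne_top hcon).symm)
    have : Subsingleton (LocalizedModule p.asIdeal.primeCompl N) := by
      rw [LocalizedModule.subsingleton_iff]
      exact fun x => ⟨t, htp, hsmul t htI x⟩
    exact Nat.card_of_subsingleton 0

/-- A module of finite length has as many elements as all its localizations at maximal ideals together. -/
theorem card_eq_finprod_card_localizedModule {R N : Type*} [CommRing R] [AddCommGroup N]
    [Module R N] (hfl : IsFiniteLength R N) :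
    (Function.mulSupport fun p : MaximalSpectrum R =>
        Nat.card (LocalizedModule p.asIdeal.primeCompl N)).Finite ∧
      ∏ᶠ p : MaximalSpectrum R, Nat.card (LocalizedModule p.asIdeal.primeCompl N) =
        Nat.card N := by
  classical
  induction hfl with
  | @of_subsingleton N _ _ _ =>
    simp
  | @of_simple_quotient N _ _ N' _ _ ih =>
    obtain ⟨hs, hp⟩ := ih
    obtain ⟨m, hm⟩ := card_localizedModule_of_isSimpleModule (R := R) (N := N ⧸ N')
    simp_rw [card_localizedModule_eq_mul _ N', hm]
    have hs' : (Function.mulSupport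
        fun p : MaximalSpectrum R => if p = m then Nat.card (N ⧸ N') else 1).Finite :=
      (Set.finite_singleton m).subset fun p hp => by
        by_contra hpm
        exact hp (if_neg hpm)
    refine ⟨(hs.union hs').subset (Function.mulSupport_mul _ _), ?_⟩
    rw [finprod_mul_distrib hs hs', hp, Submodule.card_eq_card_quotient_mul_card N']
    congr 1
    rw [finprod_eq_single _ m fun p hp => if_neg hp, if_pos rfl]

theorem quotientMk_comp_algebraMap_surjective {S M : Type*} [CommRing S] [CommRing M] [Algebra S M]
    (T : Submonoid S) [IsLocalization T M] (J : Ideal M) [Finite (S ⧸ J.comap (algebraMap S M))] :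
    Function.Surjective ((Ideal.Quotient.mk J).comp (algebraMap S M)) := by
  intro x
  obtain ⟨x, rfl⟩ := Ideal.Quotient.mk_surjective x
  obtain ⟨⟨s, t⟩, hst⟩ := IsLocalization.surj T x
  set ι := Ideal.quotientMap J (algebraMap S M) le_rfl
  have hι : Function.Injective ι := Ideal.quotientMap_injective
  have hu : IsUnit (ι (Ideal.Quotient.mk _ (t : S))) :=
    (IsLocalization.map_units M t).map (Ideal.Quotient.mk J)
  have hinj : Function.Injective fun y =>
      Ideal.Quotient.mk (J.comap (algebraMap S M)) (t : S) * y := by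
    intro a b hab
    apply hι
    have := congrArg ι hab
    simp only [map_mul] at this
    exact hu.mul_left_cancel this
  obtain ⟨y, hy⟩ := Finite.surjective_of_injective hinj
    (Ideal.Quotient.mk (J.comap (algebraMap S M)) s)
  obtain ⟨y, rfl⟩ := Ideal.Quotient.mk_surjective y
  refine ⟨y, hu.mul_left_cancel ?_⟩
  have h1 := congrArg ι hy
  simp only [map_mul] at h1
  refine h1.trans ?_
  change Ideal.Quotient.mk J (algebraMap S M s) =
    Ideal.Quotient.mk J (algebraMap S M t) * Ideal.Quotient.mk J x
  rw [← hst, map_mul, mul_comm]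

section LocalOrder

variable {R S L M : Type*} [CommRing R] [CommRing S] [CommRing L] [CommRing M]
  [Algebra R S] [Algebra R L] [Algebra S M] [Algebra L M] [Algebra R M]
  [IsScalarTower R S M] [IsScalarTower R L M]

theorem comap_eq_iff_ker_le [Algebra.IsIntegral R S] (p : MaximalSpectrum R) [IsLocalRing L]
    [IsLocalization.AtPrime L p.asIdeal]
    [IsLocalization (Algebra.algebraMapSubmonoid S p.asIdeal.primeCompl) M] (J : Ideal M)
    [Finite (S ⧸ J.comap (algebraMap S M))]
    (hJ : ∀ x ∈ J, ∃ y ∈ IsLocalRing.maximalIdeal L, algebraMap L M y = x)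
    (P : MaximalSpectrum S) :
    P.asIdeal.comap (algebraMap R S) = p.asIdeal ↔
      RingHom.ker ((Ideal.Quotient.mk J).comp (algebraMap S M)) ≤ P.asIdeal := by
  have hP := P.isMaximal
  constructor
  · intro hPp s hs
    obtain ⟨y, hy, hys⟩ := hJ _ (Ideal.Quotient.eq_zero_iff_mem.mp (RingHom.mem_ker.mp hs))
    obtain ⟨⟨r, t⟩, hrt⟩ := IsLocalization.surj p.asIdeal.primeCompl y
    have hr : r ∈ p.asIdeal := by
      rw [← IsLocalization.AtPrime.to_map_mem_maximal_iff L p.asIdeal, ← hrt]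
      exact Ideal.mul_mem_right _ _ hy
    have h1 : algebraMap S M (s * algebraMap R S t) = algebraMap S M (algebraMap R S r) := by
      rw [map_mul, ← hys, ← IsScalarTower.algebraMap_apply, ← IsScalarTower.algebraMap_apply,
        IsScalarTower.algebraMap_apply R L M, IsScalarTower.algebraMap_apply R L M, ← map_mul, hrt]
    obtain ⟨⟨_, t', ht', rfl⟩, h2⟩ := (IsLocalization.eq_iff_exists
      (Algebra.algebraMapSubmonoid S p.asIdeal.primeCompl) M).mp h1
    have hrP : algebraMap R S r ∈ P.asIdeal := by
      rwa [← Ideal.mem_comap, hPp]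
    have hnot : ∀ u ∈ p.asIdeal.primeCompl, algebraMap R S u ∉ P.asIdeal := by
      intro u hu
      rw [← Ideal.mem_comap, hPp]
      exact hu
    have h3 : algebraMap R S t' * (s * algebraMap R S t) ∈ P.asIdeal := by
      refine (congrArg (· ∈ P.asIdeal) h2).mpr ?_
      exact Ideal.mul_mem_left _ _ hrP
    exact (hP.isPrime.mem_or_mem ((hP.isPrime.mem_or_mem h3).resolve_left
      (hnot t' ht'))).resolve_right (hnot t t.2)
  · intro hker
    have hmax := Ideal.isMaximal_comap_of_isIntegral_of_isMaximal (R := R) P.asIdeal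
    refine hmax.eq_of_le p.isMaximal.ne_top fun t ht => ?_
    by_contra htp
    have hu : IsUnit (algebraMap S M (algebraMap R S t)) :=
      IsLocalization.map_units M (⟨_, t, htp, rfl⟩ :
        Algebra.algebraMapSubmonoid S p.asIdeal.primeCompl)
    obtain ⟨v, hv⟩ := hu.exists_right_inv
    obtain ⟨s, hs⟩ := quotientMk_comp_algebraMap_surjective
      (Algebra.algebraMapSubmonoid S p.asIdeal.primeCompl) J (Ideal.Quotient.mk J v)
    have h1 : algebraMap R S t * s - 1 ∈
        RingHom.ker ((Ideal.Quotient.mk J).comp (algebraMap S M)) := by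
      rw [RingHom.mem_ker, map_sub, map_mul, hs, map_one, RingHom.comp_apply, ← map_mul, hv,
        map_one, sub_self]
    have h2 := P.asIdeal.sub_mem (Ideal.mul_mem_right s _ ht) (hker h1)
    rw [sub_sub_cancel] at h2
    exact hP.ne_top ((Ideal.eq_top_iff_one _).mpr h2)

theorem card_units_quotient_of_isLocalization [Algebra.IsIntegral R S] (p : MaximalSpectrum R)
    [IsLocalRing L] [IsLocalization.AtPrime L p.asIdeal]
    [IsLocalization (Algebra.algebraMapSubmonoid S p.asIdeal.primeCompl) M] (J : Ideal M)
    [Finite (S ⧸ J.comap (algebraMap S M))]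
    (hJ : ∀ x ∈ J, ∃ y ∈ IsLocalRing.maximalIdeal L, algebraMap L M y = x) :
    Finite (M ⧸ J) ∧ (Nat.card (M ⧸ J)ˣ : ℝ) = Nat.card (M ⧸ J) *
      ∏' P : {P : MaximalSpectrum S // P.asIdeal.comap (algebraMap R S) = p.asIdeal},
        (1 - (Nat.card (S ⧸ P.1.asIdeal) : ℝ)⁻¹) := by
  have hsurj := quotientMk_comp_algebraMap_surjective
    (Algebra.algebraMapSubmonoid S p.asIdeal.primeCompl) J
  have hfin : Finite (M ⧸ J) := by
    refine Finite.of_surjective (Ideal.quotientMap J (algebraMap S M) le_rfl) fun x => ?_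
    obtain ⟨s, hs⟩ := hsurj x
    exact ⟨Ideal.Quotient.mk _ s, hs⟩
  exact ⟨hfin, card_units_of_surjective _ hsurj _ fun P => comap_eq_iff_ker_le (L := L) p J hJ P⟩

/-- The unit index at a maximal ideal `p`, in terms of the additive index. -/
theorem card_units_quotient_eq [Algebra.IsIntegral R S] (p : MaximalSpectrum R)
    [IsLocalRing L] [IsLocalization.AtPrime L p.asIdeal]
    [IsLocalization (Algebra.algebraMapSubmonoid S p.asIdeal.primeCompl) M]
    (hinj : Function.Injective (algebraMap L M)) (J : Ideal M)
    [Finite (S ⧸ J.comap (algebraMap S M))]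
    (hJ : ∀ x ∈ J, ∃ y ∈ IsLocalRing.maximalIdeal L, algebraMap L M y = x) :
    (Nat.card (Mˣ ⧸ (Units.map (algebraMap L M).toMonoidHom).range) : ℝ) =
      Nat.card (M ⧸ (algebraMap L M).toAddMonoidHom.range) *
      ((∏' P : {P : MaximalSpectrum S // P.asIdeal.comap (algebraMap R S) = p.asIdeal},
        (1 - (Nat.card (S ⧸ P.1.asIdeal) : ℝ)⁻¹)) / (1 - (Nat.card (R ⧸ p.asIdeal) : ℝ)⁻¹)) := by
  obtain ⟨hfin, hM⟩ := card_units_quotient_of_isLocalization (S := S) (L := L) p J hJ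
  have hfinR : Finite (R ⧸ (J.comap (algebraMap L M)).comap (algebraMap R L)) := by
    have hcomap : (J.comap (algebraMap L M)).comap (algebraMap R L) =
        (J.comap (algebraMap S M)).comap (algebraMap R S) := by
      rw [Ideal.comap_comap, Ideal.comap_comap, ← IsScalarTower.algebraMap_eq,
        ← IsScalarTower.algebraMap_eq]
    rw [hcomap]
    exact Finite.of_injective _ (Ideal.quotientMap_injective (f := algebraMap R S))
  have hloc : IsLocalization (Algebra.algebraMapSubmonoid R p.asIdeal.primeCompl) L := by
    rw [Algebra.algebraMapSubmonoid_self]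
    infer_instance
  obtain ⟨hfinL, hL⟩ := card_units_quotient_of_isLocalization (S := R) (L := L) (M := L) p
    (J.comap (algebraMap L M)) fun x hx => by
      obtain ⟨y, hy, hyx⟩ := hJ _ hx
      exact ⟨x, hinj hyx ▸ hy, rfl⟩
  have huniq : ∏' P : {P : MaximalSpectrum R // P.asIdeal.comap (algebraMap R R) = p.asIdeal},
      (1 - (Nat.card (R ⧸ P.1.asIdeal) : ℝ)⁻¹) = 1 - (Nat.card (R ⧸ p.asIdeal) : ℝ)⁻¹ := by
    have hsub : ∀ P : {P : MaximalSpectrum R // P.asIdeal.comap (algebraMap R R) = p.asIdeal},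
        P = ⟨p, Ideal.comap_id _⟩ := fun P =>
      Subtype.ext (MaximalSpectrum.ext ((Ideal.comap_id _).symm.trans P.2))
    rw [tprod_eq_mulSingle ⟨p, Ideal.comap_id _⟩ fun P hP => absurd (hsub P) hP]
  rw [huniq] at hL
  obtain ⟨h1, h2⟩ := card_units_quotient_mul (algebraMap L M) hinj J hJ
  have h1' := congrArg (Nat.cast (R := ℝ)) h1
  have h2' := congrArg (Nat.cast (R := ℝ)) h2
  push_cast at h1' h2'
  have hpos : (Nat.card (L ⧸ J.comap (algebraMap L M))ˣ : ℝ) ≠ 0 := by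
    have : 0 < Nat.card (L ⧸ J.comap (algebraMap L M))ˣ := Nat.card_pos
    positivity
  have hne := right_ne_zero_of_mul (hL ▸ hpos)
  rw [← mul_div_assoc, eq_div_iff hne]
  refine mul_right_cancel₀ (left_ne_zero_of_mul (hL ▸ hpos)) ?_
  rw [mul_assoc, mul_comm (_ - _), ← hL, h1', hM, ← h2']
  ring

theorem card_localizedModule_quotient_range (p : Submonoid R) [IsLocalization p L]
    [IsLocalization (Algebra.algebraMapSubmonoid S p) M] :
    Nat.card (LocalizedModule p (S ⧸ LinearMap.range (Algebra.linearMap R S))) =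
      Nat.card (M ⧸ (algebraMap L M).toAddMonoidHom.range) := by
  set N := LinearMap.range (Algebra.linearMap R S)
  set f₀ := Algebra.linearMap R L
  set f₁ := (IsScalarTower.toAlgHom R S M).toLinearMap
  set f₂ := LocalizedModule.mkLinearMap p (S ⧸ N)
  have hex := IsLocalizedModule.map_exact p f₀ f₁ f₂ (Algebra.linearMap R S) N.mkQ
    (LinearMap.exact_map_mkQ_range _)
  have hs := IsLocalizedModule.map_surjective p f₁ f₂ N.mkQ N.mkQ_surjective
  have hmap : IsLocalizedModule.map p f₀ f₁ (Algebra.linearMap R S) =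
      (IsScalarTower.toAlgHom R L M).toLinearMap := by
    refine IsLocalizedModule.ext p f₀ (IsLocalizedModule.map_units f₁) ?_
    ext
    simpa [f₀, f₁] using IsLocalizedModule.map_apply p f₀ f₁ (Algebra.linearMap R S) 1
  rw [hmap] at hex
  have hrange : (algebraMap L M).toAddMonoidHom.range =
      (IsLocalizedModule.map p f₁ f₂ N.mkQ).toAddMonoidHom.ker := by
    ext x
    exact (hex x).symm
  rw [hrange]
  exact (Nat.card_congr (QuotientAddGroup.quotientKerEquivOfSurjective
    (IsLocalizedModule.map p f₁ f₂ N.mkQ).toAddMonoidHom hs).toEquiv).symm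

end LocalOrder

theorem finite_integralClosure_pi {m : ℕ} (K : Fin m → Type) [∀ i, Field (K i)]
    [∀ i, NumberField (K i)] : Module.Finite ℤ ↥(integralClosure ℤ (Π i, K i)) := by
  let f : ↥(integralClosure ℤ (Π i, K i)) →ₗ[ℤ] (Π i, 𝓞 (K i)) :=
    LinearMap.pi fun i => AddMonoidHom.toIntLinearMap
      { toFun := fun x => ⟨x.1 i, x.2.map (Pi.evalAlgHom ℤ K i)⟩
        map_zero' := rfl
        map_add' := fun _ _ => rfl }
  refine Module.Finite.of_injective f fun x y h => Subtype.ext (funext fun i => ?_)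
  exact congrArg (fun z : Π i, 𝓞 (K i) => (z i : K i)) h

theorem exists_natCast_mem_of_isMaximal {R : Type*} [CommRing R] [Algebra.IsIntegral ℤ R]
    (p : Ideal R) [p.IsMaximal] : ∃ l : ℕ, 0 < l ∧ (l : R) ∈ p := by
  have hmax := Ideal.isMaximal_comap_of_isIntegral_of_isMaximal (R := ℤ) p
  obtain ⟨a, ha, ha0⟩ := Submodule.exists_mem_ne_zero_of_ne_bot
    (Ring.ne_bot_of_isMaximal_of_not_isField hmax Int.not_isField)
  refine ⟨a.natAbs, Int.natAbs_pos.mpr ha0, ?_⟩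
  have : ((a.natAbs : ℤ) : R) ∈ p := by
    rcases Int.natAbs_eq a with h | h
    · rw [← h]
      exact ha
    · rw [show (a.natAbs : ℤ) = -a by omega, Int.cast_neg]
      exact p.neg_mem ha
  rwa [Int.cast_natCast] at this

theorem finite_quotient_of_natCast_mem {S : Type*} [CommRing S] [Module.Finite ℤ S] (I : Ideal S)
    {n : ℕ} (hn : 0 < n) (hnI : (n : S) ∈ I) : Finite (S ⧸ I) := by
  have : Module.Finite ℤ (S ⧸ I) :=
    Module.Finite.of_surjective ((Ideal.Quotient.mk I).toAddMonoidHom.toIntLinearMap)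
      Ideal.Quotient.mk_surjective
  refine Module.finite_of_fg_torsion _ fun x => ?_
  refine ⟨⟨n, mem_nonZeroDivisors_of_ne_zero (by exact_mod_cast hn.ne')⟩, ?_⟩
  obtain ⟨x, rfl⟩ := Ideal.Quotient.mk_surjective x
  change (n : ℤ) • Ideal.Quotient.mk I x = 0
  rw [← map_zsmul, Ideal.Quotient.eq_zero_iff_mem, zsmul_eq_mul]
  exact I.mul_mem_right _ (by exact_mod_cast hnI)

section Order

variable {A : Type} [CommRing A] (O : Subalgebra ℤ A) (hle : O ≤ integralClosure ℤ A)

/-- The normalization of an order `O`, as an algebra over `O`. -/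
abbrev normalizationAlgebra : Algebra ↥O ↥(integralClosure ℤ A) :=
  (Subalgebra.inclusion hle).toRingHom.toAlgebra

theorem normLocMap_injective (𝔭 : MaximalSpectrum ↥O) : Function.Injective (normLocMap O hle 𝔭) :=
  IsLocalization.map_injective_of_injective _ _ _ (Subalgebra.inclusion_injective hle)

theorem normLocMap_comp_algebraMap (𝔭 : MaximalSpectrum ↥O) (r : ↥O) :
    normLocMap O hle 𝔭 (algebraMap _ _ r) =
      algebraMap ↥(integralClosure ℤ A) (NormLoc O hle 𝔭) (Subalgebra.inclusion hle r) :=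
  IsLocalization.map_eq _ r

theorem card_localUnitsQuot [Module.Finite ℤ ↥(integralClosure ℤ A)]
    (𝔭 : MaximalSpectrum ↥O) {n : ℕ} (hn : 0 < n)
    (hnO : ∀ s : ↥(integralClosure ℤ A), ∃ r ∈ 𝔭.asIdeal, Subalgebra.inclusion hle r = n * s) :
    (Nat.card (localUnitsQuot O hle 𝔭) : ℝ) =
      Nat.card (NormLoc O hle 𝔭 ⧸ (normLocMap O hle 𝔭).toAddMonoidHom.range) *
      ((∏' 𝔓 : {𝔓 : MaximalSpectrum ↥(integralClosure ℤ A) //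
            Ideal.comap ((Subalgebra.inclusion hle).toRingHom :
              ↥O →+* ↥(integralClosure ℤ A)) 𝔓.asIdeal = 𝔭.asIdeal},
          (1 - (Nat.card (↥(integralClosure ℤ A) ⧸ 𝔓.1.asIdeal) : ℝ)⁻¹)) /
        (1 - (Nat.card (↥O ⧸ 𝔭.asIdeal) : ℝ)⁻¹)) := by
  let := normalizationAlgebra O hle
  let : Algebra (Localization.AtPrime 𝔭.asIdeal) (NormLoc O hle 𝔭) := (normLocMap O hle 𝔭).toAlgebra
  let : Algebra ↥O (NormLoc O hle 𝔭) :=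
    ((algebraMap ↥(integralClosure ℤ A) (NormLoc O hle 𝔭)).comp
      (algebraMap ↥O ↥(integralClosure ℤ A))).toAlgebra
  have : IsScalarTower ↥O ↥(integralClosure ℤ A) (NormLoc O hle 𝔭) :=
    IsScalarTower.of_algebraMap_eq fun _ => rfl
  have : IsScalarTower ↥O (Localization.AtPrime 𝔭.asIdeal) (NormLoc O hle 𝔭) :=
    IsScalarTower.of_algebraMap_eq fun r => (normLocMap_comp_algebraMap O hle 𝔭 r).symm
  have : IsLocalization (Algebra.algebraMapSubmonoid ↥(integralClosure ℤ A) 𝔭.asIdeal.primeCompl)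
      (NormLoc O hle 𝔭) := NormLoc.instIsLocalization O hle 𝔭
  have : Algebra.IsIntegral ↥O ↥(integralClosure ℤ A) :=
    ⟨fun s => (Algebra.IsIntegral.isIntegral (R := ℤ) s).tower_top⟩
  set J : Ideal (NormLoc O hle 𝔭) := Ideal.span {(n : NormLoc O hle 𝔭)}
  have : Finite (↥(integralClosure ℤ A) ⧸ J.comap (algebraMap ↥(integralClosure ℤ A) (NormLoc O hle 𝔭))) := by
    refine finite_quotient_of_natCast_mem _ hn ?_
    rw [Ideal.mem_comap, map_natCast]
    exact Ideal.mem_span_singleton_self _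
  refine card_units_quotient_eq (R := ↥O) (S := ↥(integralClosure ℤ A))
    (L := Localization.AtPrime 𝔭.asIdeal) (M := NormLoc O hle 𝔭) 𝔭
    (normLocMap_injective O hle 𝔭) J fun x hx => ?_
  obtain ⟨y, rfl⟩ := Ideal.mem_span_singleton'.mp hx
  obtain ⟨⟨s, _, t, ht, rfl⟩, hst⟩ := IsLocalization.surj
    (Algebra.algebraMapSubmonoid ↥(integralClosure ℤ A) 𝔭.asIdeal.primeCompl) y
  obtain ⟨r, hr, hrs⟩ := hnO s
  refine ⟨IsLocalization.mk' _ r (⟨t, ht⟩ : 𝔭.asIdeal.primeCompl), ?_, ?_⟩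
  · rw [IsLocalization.AtPrime.mk'_mem_maximal_iff (Localization.AtPrime 𝔭.asIdeal) 𝔭.asIdeal]
    exact hr
  · have hu : IsUnit (algebraMap ↥(integralClosure ℤ A) (NormLoc O hle 𝔭) (algebraMap ↥O _ t)) :=
      IsLocalization.map_units _ (⟨_, t, ht, rfl⟩ :
        Algebra.algebraMapSubmonoid ↥(integralClosure ℤ A) 𝔭.asIdeal.primeCompl)
    refine hu.mul_right_cancel ?_
    have h1 := congrArg (algebraMap (Localization.AtPrime 𝔭.asIdeal) (NormLoc O hle 𝔭))
      (IsLocalization.mk'_spec (Localization.AtPrime 𝔭.asIdeal) r (⟨t, ht⟩ : 𝔭.asIdeal.primeCompl))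
    rw [map_mul, ← IsScalarTower.algebraMap_apply, ← IsScalarTower.algebraMap_apply,
      IsScalarTower.algebraMap_apply ↥O ↥(integralClosure ℤ A) _ t,
      IsScalarTower.algebraMap_apply ↥O ↥(integralClosure ℤ A) _ r] at h1
    refine h1.trans ?_
    have h2 : algebraMap ↥O ↥(integralClosure ℤ A) r = n * s := hrs
    rw [h2, map_mul, map_natCast, ← hst]
    ring

theorem tprod_card_localUnitsQuot [Module.Finite ℤ ↥(integralClosure ℤ A)]
    (hK : ∀ x : A, ∃ n : ℕ, 0 < n ∧ n • x ∈ O) :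
    ∏' 𝔭 : MaximalSpectrum ↥O, (Nat.card (localUnitsQuot O hle 𝔭) : ℝ) =
      (Nat.card (↥(integralClosure ℤ A) ⧸
        ((Subalgebra.inclusion hle).toRingHom :
          ↥O →+* ↥(integralClosure ℤ A)).toAddMonoidHom.range) : ℝ) *
      ∏' 𝔭 : MaximalSpectrum ↥O,
        ((∏' 𝔓 : {𝔓 : MaximalSpectrum ↥(integralClosure ℤ A) //
            Ideal.comap ((Subalgebra.inclusion hle).toRingHom :
              ↥O →+* ↥(integralClosure ℤ A)) 𝔓.asIdeal = 𝔭.asIdeal},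
          (1 - (Nat.card (↥(integralClosure ℤ A) ⧸ 𝔓.1.asIdeal) : ℝ)⁻¹)) /
        (1 - (Nat.card (↥O ⧸ 𝔭.asIdeal) : ℝ)⁻¹)) := by
  let := normalizationAlgebra O hle
  set N := LinearMap.range (Algebra.linearMap ↥O ↥(integralClosure ℤ A))
  have : Finite (↥(integralClosure ℤ A) ⧸ N) := by
    have : Module.Finite ℤ (↥(integralClosure ℤ A) ⧸ N) :=
      Module.Finite.of_surjective N.mkQ.toAddMonoidHom.toIntLinearMap N.mkQ_surjective
    refine Module.finite_of_fg_torsion _ fun x => ?_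
    obtain ⟨x, rfl⟩ := N.mkQ_surjective x
    obtain ⟨n, hn, hnx⟩ := hK x
    refine ⟨⟨n, mem_nonZeroDivisors_of_ne_zero (by exact_mod_cast hn.ne')⟩, ?_⟩
    change (n : ℤ) • N.mkQ x = 0
    rw [← map_zsmul, Submodule.mkQ_apply, Submodule.Quotient.mk_eq_zero, natCast_zsmul]
    exact ⟨⟨_, hnx⟩, rfl⟩
  have : Algebra.IsIntegral ℤ ↥O := ⟨fun x =>
    (isIntegral_algHom_iff O.val Subtype.val_injective).mp (hle x.2)⟩
  set d := Nat.card (↥(integralClosure ℤ A) ⧸ N)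
  have hd : ∀ s : ↥(integralClosure ℤ A), ∃ r : ↥O, Subalgebra.inclusion hle r = d * s := by
    intro s
    have h : d • N.mkQ s = 0 := card_nsmul_eq_zero'
    rw [← map_nsmul, Submodule.mkQ_apply, Submodule.Quotient.mk_eq_zero, nsmul_eq_mul] at h
    exact h
  set e : MaximalSpectrum ↥O → ℝ := fun 𝔭 =>
    ((∏' 𝔓 : {𝔓 : MaximalSpectrum ↥(integralClosure ℤ A) //
            Ideal.comap ((Subalgebra.inclusion hle).toRingHom :
              ↥O →+* ↥(integralClosure ℤ A)) 𝔓.asIdeal = 𝔭.asIdeal},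
          (1 - (Nat.card (↥(integralClosure ℤ A) ⧸ 𝔓.1.asIdeal) : ℝ)⁻¹)) /
        (1 - (Nat.card (↥O ⧸ 𝔭.asIdeal) : ℝ)⁻¹))
  set q : MaximalSpectrum ↥O → ℕ := fun 𝔭 =>
    Nat.card (LocalizedModule 𝔭.asIdeal.primeCompl (↥(integralClosure ℤ A) ⧸ N))
  have hq' : ∀ 𝔭, q 𝔭 =
      Nat.card (NormLoc O hle 𝔭 ⧸ (normLocMap O hle 𝔭).toAddMonoidHom.range) := by
    intro 𝔭
    let : Algebra (Localization.AtPrime 𝔭.asIdeal) (NormLoc O hle 𝔭) :=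
      (normLocMap O hle 𝔭).toAlgebra
    let : Algebra ↥O (NormLoc O hle 𝔭) :=
      ((algebraMap ↥(integralClosure ℤ A) (NormLoc O hle 𝔭)).comp
        (algebraMap ↥O ↥(integralClosure ℤ A))).toAlgebra
    have : IsScalarTower ↥O ↥(integralClosure ℤ A) (NormLoc O hle 𝔭) :=
      IsScalarTower.of_algebraMap_eq fun _ => rfl
    have : IsScalarTower ↥O (Localization.AtPrime 𝔭.asIdeal) (NormLoc O hle 𝔭) :=
      IsScalarTower.of_algebraMap_eq fun r => (normLocMap_comp_algebraMap O hle 𝔭 r).symm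
    have : IsLocalization (Algebra.algebraMapSubmonoid ↥(integralClosure ℤ A)
        𝔭.asIdeal.primeCompl) (NormLoc O hle 𝔭) := NormLoc.instIsLocalization O hle 𝔭
    exact card_localizedModule_quotient_range (L := Localization.AtPrime 𝔭.asIdeal)
      (M := NormLoc O hle 𝔭) 𝔭.asIdeal.primeCompl
  have ha : ∀ 𝔭, (Nat.card (localUnitsQuot O hle 𝔭) : ℝ) = q 𝔭 * e 𝔭 := by
    intro 𝔭
    obtain ⟨l, hl, hlp⟩ := exists_natCast_mem_of_isMaximal 𝔭.asIdeal
    rw [hq' 𝔭]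
    refine card_localUnitsQuot O hle 𝔭 (n := l * d) (Nat.mul_pos hl Nat.card_pos) fun s => ?_
    obtain ⟨r, hr⟩ := hd s
    refine ⟨l * r, Ideal.mul_mem_right _ _ hlp, ?_⟩
    rw [map_mul, hr, map_natCast]
    push_cast
    ring
  obtain ⟨hfin, hprod⟩ := card_eq_finprod_card_localizedModule (R := ↥O)
    (N := ↥(integralClosure ℤ A) ⧸ N)
    (isFiniteLength_iff_isNoetherian_isArtinian.mpr ⟨inferInstance, inferInstance⟩)
  have ha1 : ∀ 𝔭, q 𝔭 = 1 → Nat.card (localUnitsQuot O hle 𝔭) = 1 := by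
    intro 𝔭 h
    rw [hq' 𝔭] at h
    have hsurj : Function.Surjective (normLocMap O hle 𝔭) :=
      AddMonoidHom.range_eq_top.mp (AddSubgroup.index_eq_one.mp h)
    refine Subgroup.index_eq_one.mpr (MonoidHom.range_eq_top.mpr ?_)
    exact (Units.mapEquiv (RingEquiv.ofBijective (normLocMap O hle 𝔭)
      ⟨normLocMap_injective O hle 𝔭, hsurj⟩).toMulEquiv).surjective
  have hfinq : (Function.mulSupport fun 𝔭 => (q 𝔭 : ℝ)).Finite :=
    hfin.subset fun 𝔭 h h1 => h (congrArg Nat.cast h1 |>.trans Nat.cast_one)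
  have hfine : (Function.mulSupport e).Finite := by
    refine hfin.subset fun 𝔭 h h1 => h ?_
    have := ha 𝔭
    rw [ha1 𝔭 h1, show q 𝔭 = 1 from h1, Nat.cast_one, one_mul] at this
    exact this.symm
  have hcast : ∏ᶠ 𝔭, (q 𝔭 : ℝ) = (d : ℝ) := by
    rw [show d = _ from hprod.symm]
    exact ((Nat.castRingHom ℝ).toMonoidHom.map_finprod hfin).symm
  rw [tprod_congr ha, tprod_eq_finprod ((hfinq.union hfine).subset (Function.mulSupport_mul _ _)),
    finprod_mul_distrib hfinq hfine, hcast, tprod_eq_finprod hfine]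
  rfl

end Order

/-- `∏_𝔭 #(𝒪̃_𝔭ˣ/𝒪_𝔭ˣ) = #(𝒪̃/𝒪) · ∏_𝔭 [∏_{𝔓|𝔭} (1 - N𝔓⁻¹)] / (1 - N𝔭⁻¹)`. -/
theorem stmt11 {m : ℕ} (K : Fin m → Type) [∀ i, Field (K i)] [∀ i, NumberField (K i)]
    (O : Subalgebra ℤ (Π i, K i)) (hfg : Module.Finite ℤ ↥O)
    (hK : ∀ x : Π i, K i, ∃ n : ℕ, 0 < n ∧ n • x ∈ O)
    (hle : O ≤ integralClosure ℤ (Π i, K i)) :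
    ∏' 𝔭 : MaximalSpectrum ↥O, (Nat.card (localUnitsQuot O hle 𝔭) : ℝ) =
      (Nat.card (↥(integralClosure ℤ (Π i, K i)) ⧸
        ((Subalgebra.inclusion hle).toRingHom :
          ↥O →+* ↥(integralClosure ℤ (Π i, K i))).toAddMonoidHom.range) : ℝ) *
      ∏' 𝔭 : MaximalSpectrum ↥O,
        ((∏' 𝔓 : {𝔓 : MaximalSpectrum ↥(integralClosure ℤ (Π i, K i)) //
            Ideal.comap ((Subalgebra.inclusion hle).toRingHom :
              ↥O →+* ↥(integralClosure ℤ (Π i, K i))) 𝔓.asIdeal = 𝔭.asIdeal},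
          (1 - (Nat.card (↥(integralClosure ℤ (Π i, K i)) ⧸ 𝔓.1.asIdeal) : ℝ)⁻¹)) /
        (1 - (Nat.card (↥O ⧸ 𝔭.asIdeal) : ℝ)⁻¹)) := by
  exact @tprod_card_localUnitsQuot _ _ O hle (finite_integralClosure_pi K) hK

end
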